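/- Let A = (A_T, A_N, ι, A_0) be a constraint k-algebra and f = (f_T, f_N) a constraint n-cochain on A. Then δf = (δf_T, δf_N) is a constraint (n+1)-cochain on A; if f lies in the 0-component, then δf lies in the 0-component; and δ(δf) = 0, i.e. δ(δf_T) = 0 and δ(δf_N) = 0. -/

import Mathlib

universe u v w

/-- A constraint `k`-algebra: two associative `k`-algebras `A_T` and `A_N`,
a `k`-algebra homomorphism `ι : A_N → A_T`, and a two-sided ideal `A_0 ⊆ A_N`. -/
structure ConstraintAlgebra (k : Type u) [CommRing k] (AT : Type v) (AN : Type w)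
    [Ring AT] [Ring AN] [Algebra k AT] [Algebra k AN] where
  iota : AN →ₐ[k] AT
  zero : Submodule k AN
  mul_mem_zero : ∀ x a : AN, a ∈ zero → x * a ∈ zero
  mem_zero_mul : ∀ x a : AN, a ∈ zero → a * x ∈ zero

/-- `k`-multilinearity of a map `(Fin n → M) → M`. -/
def IsMultilinearFn (k : Type u) {M : Type v} [CommRing k] [AddCommGroup M] [Module k M]
    {n : ℕ} (f : (Fin n → M) → M) : Prop :=
  (∀ (v : Fin n → M) (i : Fin n) (x y : M),
      f (Function.update v i (x + y)) = f (Function.update v i x) + f (Function.update v i y)) ∧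
  ∀ (v : Fin n → M) (i : Fin n) (c : k) (x : M),
      f (Function.update v i (c • x)) = c • f (Function.update v i x)

/-- The Hochschild differential of an `n`-multilinear map, with respect to a
multiplication `mul`:
`(δφ)(a_0,…,a_n) = a_0·φ(a_1,…,a_n) + Σ_{i=0}^{n−1} (−1)^{i+1} φ(a_0,…,a_i·a_{i+1},…,a_n)
  + (−1)^{n+1} φ(a_0,…,a_{n−1})·a_n`. -/
def hochschildDiffM {M : Type v} [AddCommGroup M] (mul : M → M → M) {n : ℕ}
    (φ : (Fin n → M) → M) : (Fin (n + 1) → M) → M := fun a =>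
  mul (a 0) (φ fun j => a j.succ)
    + (∑ i : Fin n, ((-1 : ℤ) ^ (i.val + 1)) •
        φ fun j => if j.val < i.val then a j.castSucc
          else if j.val = i.val then mul (a j.castSucc) (a j.succ)
          else a j.succ)
    + ((-1 : ℤ) ^ (n + 1)) • mul (φ fun j => a j.castSucc) (a (Fin.last n))

variable {k : Type u} [CommRing k] {AT : Type v} {AN : Type w}
  [Ring AT] [Ring AN] [Algebra k AT] [Algebra k AN]

/-- A constraint `n`-cochain on a constraint algebra: a pair of `k`-multilinear maps
compatible with `ι` and mapping tuples with an entry in `A_0` into `A_0`. -/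
def IsConstraintCochain (A : ConstraintAlgebra k AT AN) {n : ℕ}
    (fT : (Fin n → AT) → AT) (fN : (Fin n → AN) → AN) : Prop :=
  IsMultilinearFn k fT ∧ IsMultilinearFn k fN ∧
    (∀ a : Fin n → AN, A.iota (fN a) = fT fun i => A.iota (a i)) ∧
    ∀ a : Fin n → AN, (∃ i, a i ∈ A.zero) → fN a ∈ A.zero

/-- contraction of the entries `i` and `i+1` of a tuple -/
def hcContr {M : Type*} [Mul M] {n : ℕ} (i : ℕ) (a : Fin (n + 1) → M) : Fin n → M := fun j =>
  if j.val < i then a j.castSucc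
    else if j.val = i then a j.castSucc * a j.succ else a j.succ

theorem hc_eq {M : Type*} [Ring M] {n : ℕ} (φ : (Fin n → M) → M) (a : Fin (n + 1) → M) :
    hochschildDiffM (· * ·) φ a = a 0 * φ (fun j => a j.succ)
      + (∑ i : Fin n, ((-1 : ℤ) ^ (i.val + 1)) • φ (hcContr i.val a))
      + ((-1 : ℤ) ^ (n + 1)) • (φ (fun j => a j.castSucc) * a (Fin.last n)) := rfl

theorem hc_double {M : Type*} [AddCommGroup M] (n : ℕ) (F : ℕ → ℕ → M)
    (h : ∀ i j, i ≤ j → j < n → F i j = F (j + 1) i) :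
    ∑ i ∈ Finset.range (n + 1), ∑ j ∈ Finset.range n, ((-1 : ℤ) ^ (i + j)) • F i j = 0 := by
  induction n with
  | zero => simp
  | succ n ih =>
    rw [Finset.sum_range_succ]
    simp only [Finset.sum_range_succ _ n, Finset.sum_add_distrib]
    have ih' := ih (fun i j hij hj => h i j hij (by omega))
    rw [Finset.sum_range_succ] at ih'
    have e : ∀ i ∈ Finset.range (n + 1),
        ((-1 : ℤ) ^ (i + n)) • F i n = - (((-1 : ℤ) ^ (n + 1 + i)) • F (n + 1) i) := by
      intro i hi
      rw [h i n (by simp at hi; omega) (by omega), ← neg_smul]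
      congr 1
      ring
    have e2 := Finset.sum_congr rfl e
    rw [Finset.sum_neg_distrib] at e2
    simp only [Finset.sum_range_succ _ n] at e2
    rw [← eq_neg_iff_add_eq_zero, ← e2, ← sub_eq_zero]
    rw [← ih']
    abel

theorem hc_contr_contr {M : Type*} [Ring M] {n : ℕ} (i j : ℕ) (hij : i ≤ j)
    (a : Fin (n + 2) → M) : hcContr j (hcContr i a) = hcContr i (hcContr (j + 1) a) := by
  funext m
  simp only [hcContr, Fin.val_castSucc, Fin.val_succ, Fin.castSucc_succ]
  split_ifs <;> first | rfl | omega | (simp only [mul_assoc])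

theorem hc_sq {k : Type*} [CommRing k] {M : Type*} [Ring M] [Algebra k M] {n : ℕ}
    (φ : (Fin n → M) → M) (a : Fin (n + 2) → M) :
    hochschildDiffM (· * ·) (hochschildDiffM (· * ·) φ) a = 0 := by
  have key : ∑ i : Fin (n + 1), ∑ j : Fin n,
      ((-1 : ℤ) ^ (i.val + 1)) • ((-1 : ℤ) ^ (j.val + 1)) • φ (hcContr j.val (hcContr i.val a)) = 0 := by
    have := hc_double n (fun i j => φ (hcContr j (hcContr i a)))
      (fun i j hij _ => by simp only [hc_contr_contr i j hij])
    rw [Finset.sum_range] at this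
    simp only [Finset.sum_range] at this
    rw [← this]
    refine Finset.sum_congr rfl fun i _ => Finset.sum_congr rfl fun j _ => ?_
    rw [smul_smul]
    congr 1
    ring
  have h1 : ∑ i : Fin (n + 1), ((-1 : ℤ) ^ (i.val + 1)) •
      (hcContr i.val a 0 * φ (fun j => hcContr i.val a j.succ))
      = - (a 0 * (a 1 * φ (fun j => a j.succ.succ)))
        - a 0 * ∑ i : Fin n, ((-1 : ℤ) ^ (i.val + 1)) • φ (hcContr i.val (fun j => a j.succ)) := by
    rw [Fin.sum_univ_succ, sub_eq_add_neg, Finset.mul_sum, ← Finset.sum_neg_distrib]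
    congr 1
    · simp [hcContr, mul_assoc]
    · refine Finset.sum_congr rfl fun i _ => ?_
      have e : (fun j : Fin n => hcContr i.succ.val a j.succ) = hcContr i.val (fun j => a j.succ) := by
        funext j
        simp [hcContr]
      rw [e, mul_smul_comm, ← neg_smul]
      have e2 : hcContr i.succ.val a 0 = a 0 := by simp [hcContr]
      rw [e2, Fin.val_succ]
      congr 1
      ring
  have h2 : ∑ i : Fin (n + 1), ((-1 : ℤ) ^ (i.val + 1)) •
      (φ (fun j => hcContr i.val a j.castSucc) * hcContr i.val a (Fin.last n))
      = (∑ i : Fin n, ((-1 : ℤ) ^ (i.val + 1)) • φ (hcContr i.val (fun j => a j.castSucc)))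
          * a (Fin.last (n + 1))
        + ((-1 : ℤ) ^ (n + 1)) •
          (φ (fun j => a j.castSucc.castSucc) * a (Fin.last n).castSucc * a (Fin.last (n + 1))) := by
    rw [Fin.sum_univ_castSucc, Finset.sum_mul]
    congr 1
    · refine Finset.sum_congr rfl fun i _ => ?_
      have e : (fun j : Fin n => hcContr i.castSucc.val a j.castSucc)
          = hcContr i.val (fun j => a j.castSucc) := by
        funext j
        simp [hcContr]
      have e2 : hcContr i.castSucc.val a (Fin.last n) = a (Fin.last (n + 1)) := by
        have := i.isLt
        simp only [hcContr, Fin.val_castSucc, Fin.val_last, Fin.succ_last]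
        rw [if_neg (by omega), if_neg (by omega)]
      rw [e, e2, smul_mul_assoc]
      simp
    · simp [hcContr, mul_assoc]
  rw [hc_eq]
  simp only [hc_eq, smul_add, Finset.sum_add_distrib, Finset.smul_sum, key, h1]
  have h3 : ∀ i : Fin (n + 1), ((-1 : ℤ) ^ (i.val + 1)) • ((-1 : ℤ) ^ (n + 1)) •
      (φ (fun j => hcContr i.val a j.castSucc) * hcContr i.val a (Fin.last n))
      = ((-1 : ℤ) ^ (n + 1)) • (((-1 : ℤ) ^ (i.val + 1)) •
      (φ (fun j => hcContr i.val a j.castSucc) * hcContr i.val a (Fin.last n))) :=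
    fun i => smul_comm _ _ _
  simp only [h3, ← Finset.smul_sum, h2]
  have s : ((-1 : ℤ) ^ (n + 1 + 1)) = - ((-1 : ℤ) ^ (n + 1)) := by ring
  rw [s]
  simp only [mul_add, add_mul, smul_add, neg_smul, mul_smul_comm, smul_mul_assoc, Fin.succ_zero_eq_one,
    Fin.castSucc_zero, Fin.succ_last, Fin.succ_castSucc, mul_assoc]
  abel

theorem hc_contr_update {k : Type*} [CommRing k] {M : Type*} [Ring M] [Algebra k M] {n : ℕ}
    (i : Fin n) (v : Fin (n + 1) → M) (m : Fin (n + 1)) :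
    ∃ (p : Fin n) (g : M →ₗ[k] M), ∀ x,
      hcContr i.val (Function.update v m x) = Function.update (hcContr i.val v) p (g x) := by
  have hi := i.isLt
  have hm := m.isLt
  rcases lt_trichotomy m.val i.val with h | h | h
  · refine ⟨⟨m.val, by omega⟩, LinearMap.id, fun x => ?_⟩
    funext j
    simp only [hcContr, Function.update_apply, Fin.ext_iff, Fin.val_castSucc, Fin.val_succ,
      LinearMap.id_apply]
    split_ifs <;> first | rfl | omega
  · refine ⟨i, LinearMap.mulRight k (v i.succ), fun x => ?_⟩
    funext j
    by_cases hj : j = i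
    · subst hj
      have : m = j.castSucc := Fin.ext h
      subst this
      simp [hcContr, Function.update_apply, Fin.ext_iff]
    · have hj' : j.val ≠ i.val := fun e => hj (Fin.ext e)
      simp only [hcContr, Function.update_apply, Fin.ext_iff, Fin.val_castSucc, Fin.val_succ]
      split_ifs <;> first | rfl | omega
  · by_cases h' : m.val = i.val + 1
    · refine ⟨i, LinearMap.mulLeft k (v i.castSucc), fun x => ?_⟩
      funext j
      by_cases hj : j = i
      · subst hj
        have : m = j.succ := Fin.ext h'
        subst this
        simp [hcContr, Function.update_apply, Fin.ext_iff]
      · have hj' : j.val ≠ i.val := fun e => hj (Fin.ext e)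
        simp only [hcContr, Function.update_apply, Fin.ext_iff, Fin.val_castSucc, Fin.val_succ]
        split_ifs <;> first | rfl | omega
    · refine ⟨⟨m.val - 1, by omega⟩, LinearMap.id, fun x => ?_⟩
      funext j
      simp only [hcContr, Function.update_apply, Fin.ext_iff, Fin.val_castSucc, Fin.val_succ,
        LinearMap.id_apply]
      split_ifs <;> first | rfl | omega

theorem hc_tail_update {M : Type*} {n : ℕ} (v : Fin (n + 1) → M) (p : Fin n) (x : M) :
    (fun j : Fin n => Function.update v p.succ x j.succ)
      = Function.update (fun j => v j.succ) p x := by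
  funext j
  simp [Function.update_apply]

theorem hc_init_update {M : Type*} {n : ℕ} (v : Fin (n + 1) → M) (p : Fin n) (x : M) :
    (fun j : Fin n => Function.update v p.castSucc x j.castSucc)
      = Function.update (fun j => v j.castSucc) p x := by
  funext j
  simp [Function.update_apply]

theorem hc_multilinear {k : Type*} [CommRing k] {M : Type*} [Ring M] [Algebra k M] {n : ℕ}
    (φ : (Fin n → M) → M) (h : IsMultilinearFn k φ) :
    IsMultilinearFn k (hochschildDiffM (· * ·) φ) := by
  obtain ⟨ha, hs⟩ := h
  have H : ∀ (v : Fin (n + 1) → M) (m : Fin (n + 1)),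
      IsLinearMap k (fun x => hochschildDiffM (· * ·) φ (Function.update v m x)) := by
    intro v m
    have A1 : IsLinearMap k (fun x => (Function.update v m x) 0 *
        φ (fun j => Function.update v m x j.succ)) := by
      induction m using Fin.cases with
      | zero =>
        constructor <;> intros <;> simp [add_mul, Function.update_apply]
      | succ p =>
        simp only [hc_tail_update]
        constructor <;> intros <;> simp [ha, hs, mul_add, Function.update_apply, (Fin.succ_ne_zero _).symm]
    have A2 : IsLinearMap k (fun x => φ (fun j => Function.update v m x j.castSucc) *
        (Function.update v m x) (Fin.last n)) := by
      induction m using Fin.lastCases with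
      | last =>
        constructor <;> intros <;> simp [mul_add, Function.update_apply, Fin.castSucc_ne_last]
      | cast p =>
        simp only [hc_init_update]
        constructor <;> intros <;> simp [ha, hs, add_mul, Function.update_apply, (Fin.castSucc_ne_last _).symm]
    have A3 : ∀ i : Fin n, IsLinearMap k (fun x => φ (hcContr i.val (Function.update v m x))) := by
      intro i
      obtain ⟨p, g, hg⟩ := hc_contr_update (k := k) i v m
      simp only [hg]
      constructor <;> intros <;> simp [ha, hs]
    simp only [hc_eq]
    constructor
    · intro x y
      rw [A1.map_add, A2.map_add]
      simp only [fun i => (A3 i).map_add, smul_add, Finset.sum_add_distrib]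
      abel
    · intro c x
      rw [A1.map_smul, A2.map_smul]
      simp only [fun i => (A3 i).map_smul, smul_add, Finset.smul_sum, smul_comm c]
  exact ⟨fun v i x y => (H v i).map_add x y, fun v i c x => (H v i).map_smul c x⟩

theorem hc_mem {k : Type*} [CommRing k] {AT : Type*} {AN : Type*}
    [Ring AT] [Ring AN] [Algebra k AT] [Algebra k AN] (A : ConstraintAlgebra k AT AN) {n : ℕ}
    (i : Fin n) (a : Fin (n + 1) → AN) (h : ∃ m, a m ∈ A.zero) :
    ∃ p, hcContr i.val a p ∈ A.zero := by
  obtain ⟨m, hm⟩ := h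
  have hi := i.isLt
  have hlt := m.isLt
  rcases lt_trichotomy m.val i.val with h | h | h
  · refine ⟨⟨m.val, by omega⟩, ?_⟩
    simpa [hcContr, h] using hm
  · have : m = i.castSucc := Fin.ext h
    subst this
    exact ⟨i, by simpa [hcContr] using A.mem_zero_mul _ _ hm⟩
  · by_cases h' : m.val = i.val + 1
    · have : m = i.succ := Fin.ext h'
      subst this
      exact ⟨i, by simpa [hcContr] using A.mul_mem_zero _ _ hm⟩
    · refine ⟨⟨m.val - 1, by omega⟩, ?_⟩
      have e : (⟨m.val - 1, by omega⟩ : Fin n).succ = m := Fin.ext (by simp; omega)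
      simp only [hcContr]
      rw [if_neg (by omega), if_neg (by omega), e]
      exact hm

/-- The Hochschild differential of a constraint `n`-cochain is a
constraint `(n+1)`-cochain; it preserves the `0`-component; and `δ ∘ δ = 0` in both
components. -/
theorem hochschildDiff_constraintCochain (A : ConstraintAlgebra k AT AN) {n : ℕ}
    (fT : (Fin n → AT) → AT) (fN : (Fin n → AN) → AN)
    (hf : IsConstraintCochain A fT fN) :
    IsConstraintCochain A (hochschildDiffM (· * ·) fT) (hochschildDiffM (· * ·) fN) ∧
    ((∀ a : Fin n → AN, fN a ∈ A.zero) →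
      ∀ a : Fin (n + 1) → AN, hochschildDiffM (· * ·) fN a ∈ A.zero) ∧
    (∀ a : Fin (n + 2) → AT,
      hochschildDiffM (· * ·) (hochschildDiffM (· * ·) fT) a = 0) ∧
    (∀ a : Fin (n + 2) → AN,
      hochschildDiffM (· * ·) (hochschildDiffM (· * ·) fN) a = 0) := by
  obtain ⟨hT, hN, hi, h0⟩ := hf
  have zs : ∀ (c : ℤ) (x : AN), x ∈ A.zero → c • x ∈ A.zero := fun c x hx => zsmul_mem hx c
  refine ⟨⟨hc_multilinear fT hT, hc_multilinear fN hN, ?_, ?_⟩, ?_, hc_sq (k := k) fT,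
    hc_sq (k := k) fN⟩
  · intro a
    have e : ∀ i : ℕ, (fun j => A.iota (hcContr i a j)) = hcContr i (fun j => A.iota (a j)) := by
      intro i
      funext j
      simp only [hcContr]
      split_ifs <;> simp
    simp only [hc_eq, map_add, map_sum, map_zsmul, map_mul, hi, e]
  · rintro a h
    rw [hc_eq]
    refine add_mem (add_mem ?_ (sum_mem fun i _ => zs _ _ (h0 _ (hc_mem A i a h)))) (zs _ _ ?_)
    · obtain ⟨m, hm⟩ := h
      induction m using Fin.cases with
      | zero => exact A.mem_zero_mul _ _ hm
      | succ p => exact A.mul_mem_zero _ _ (h0 _ ⟨p, hm⟩)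
    · obtain ⟨m, hm⟩ := h
      induction m using Fin.lastCases with
      | last => exact A.mul_mem_zero _ _ hm
      | cast p => exact A.mem_zero_mul _ _ (h0 _ ⟨p, hm⟩)
  · intro h a
    rw [hc_eq]
    exact add_mem (add_mem (A.mul_mem_zero _ _ (h _)) (sum_mem fun i _ => zs _ _ (h _)))
      (zs _ _ (A.mem_zero_mul _ _ (h _)))
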